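/- Suppose Assumptions B and C are met. Fix α* ∈ ℝⁿ, let 0 < M ≤ n and 0 < δ ≤ 1, and let 𝒢^M = {G_α Δ G_{α*} : α ∈ ℝⁿ, I(α − α*) ≤ M}. Then there exist a natural number N with log N ≤ (M/δ)·(8 q₀ c_ψ² (log n)/d)·log(8 q₀ c_ψ² n/(δ d)) and pairs of Borel functions (z_i^L, z_i^U) on [0,1]^{d+1}, i = 1, …, N, such that z_i^L ≤ z_i^U pointwise, ∫ (z_i^U − z_i^L) dQ ≤ δ for each i, and for every G ∈ 𝒢^M there is an i with z_i^L ≤ 1_G ≤ z_i^U pointwise; that is, the δ-entropy with bracketing H_B(δ, 𝒢^M, Q) is at most (M/δ)(8 q₀ c_ψ² (log n)/d) log(8 q₀ c_ψ² n/(δ d)). (Lemma 3 of the paper.) -/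

import Mathlib

open MeasureTheory Finset
open scoped symmDiff

noncomputable section

/-- The unit cube `[0,1]^d ⊂ ℝ^d`. -/
def cube (d : ℕ) : Set (Fin d → ℝ) := Set.univ.pi fun _ => Set.Icc (0:ℝ) 1

/-- The unit cube `[0,1]^{d+1} = [0,1]^d × [0,1]`. -/
def cubeP (d : ℕ) : Set ((Fin d → ℝ) × ℝ) := (cube d) ×ˢ Set.Icc (0:ℝ) 1

/-- `√I(α) = Σ_{l=1}^L 2^{dl/4} √(Σ_{j∈I_l} |α_{j,l}|)`; level `l : Fin L` represents level `l+1`. -/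
def sqrtNS {L n : ℕ} (d : ℕ) (I : Fin L → Finset (Fin n)) (α : Fin n → ℝ) : ℝ :=
  ∑ l : Fin L, (2:ℝ) ^ (((d * (l.1 + 1) : ℕ) : ℝ) / 4) * Real.sqrt (∑ j ∈ I l, |α j|)

/-- The nonsparsity measure `I(α)`. -/
def NS {L n : ℕ} (d : ℕ) (I : Fin L → Finset (Fin n)) (α : Fin n → ℝ) : ℝ := (sqrtNS d I α) ^ 2

/-- `f_α = Σ_{l} Σ_{j∈I_l} α_{j,l} ψ_{j,l}`. -/
def fExp {d L n : ℕ} (I : Fin L → Finset (Fin n)) (ψ : Fin n → (Fin d → ℝ) → ℝ)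
    (α : Fin n → ℝ) : (Fin d → ℝ) → ℝ :=
  fun s => ∑ l : Fin L, ∑ j ∈ I l, α j * ψ j s

/-- The boundary fragment `G_f = {(s,t) ∈ [0,1]^d × [0,1] : f(s) ≥ t}`. -/
def fragment {d : ℕ} (f : (Fin d → ℝ) → ℝ) : Set ((Fin d → ℝ) × ℝ) :=
  {p | p.1 ∈ cube d ∧ p.2 ∈ Set.Icc (0:ℝ) 1 ∧ p.2 ≤ f p.1}

/-- Assumption B of the paper: `{ψ_{j,l}}` is an orthonormal wavelet-type system. -/
structure AssumpB (d L n : ℕ) (I : Fin L → Finset (Fin n))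
    (ψ : Fin n → (Fin d → ℝ) → ℝ) (cψ : ℝ) : Prop where
  one_le : 1 ≤ cψ
  meas : ∀ k, Measurable (ψ k)
  orthonormal : ∀ j k, (∫ s in cube d, ψ j s * ψ k s) = if j = k then 1 else 0
  l1_bound : ∀ l : Fin L, ∀ j ∈ I l,
    (∫ s in cube d, |ψ j s|) ≤ cψ * (2:ℝ) ^ (-(((d * (l.1 + 1) : ℕ) : ℝ) / 2))
  sup_bound : ∀ l : Fin L, ∀ s ∈ cube d,
    (∑ j ∈ I l, |ψ j s|) ≤ cψ * (2:ℝ) ^ ((((d * (l.1 + 1) : ℕ) : ℝ)) / 2)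
  card_lower : ∀ l : Fin L, (2:ℝ) ^ (d * (l.1 + 1)) / cψ ≤ ((I l).card : ℝ)
  card_upper : ∀ l : Fin L, ((I l).card : ℝ) ≤ cψ * (2:ℝ) ^ (d * (l.1 + 1))
  levels : (L : ℝ) ≤ cψ * Real.log n / d
  disj : ∀ l l' : Fin L, l ≠ l' → Disjoint (I l) (I l')
  total : ∑ l : Fin L, (I l).card = n

/-- `N_m = Σ_{l=1}^m |I_l|`. -/
def Nm {L n : ℕ} (I : Fin L → Finset (Fin n)) (m : ℕ) : ℕ :=
  ∑ l ∈ Finset.univ.filter (fun l : Fin L => l.1 + 1 ≤ m), (I l).card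

/-- `m(α) = min{m : α_{j,l} = 0 for all j ∈ I_l with l > m}`. -/
def mlev {L n : ℕ} (I : Fin L → Finset (Fin n)) (α : Fin n → ℝ) : ℕ :=
  sInf {m | ∀ l : Fin L, m < l.1 + 1 → ∀ j ∈ I l, α j = 0}

/-- `N(α) = N_{m(α)}`. -/
def Nlev {L n : ℕ} (I : Fin L → Finset (Fin n)) (α : Fin n → ℝ) : ℕ := Nm I (mlev I α)

/-- There are at most `(2n+1)^m` integer vectors of length `n` with `ℓ¹`-norm at most `m`. -/
lemma exists_finset_int_l1_ball (n m : ℕ) :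
    ∃ S : Finset (Fin n → ℤ), S.card ≤ (2 * n + 1) ^ m ∧
      ∀ k : Fin n → ℤ, ∑ j, |k j| ≤ (m : ℤ) → k ∈ S := by
  classical
  induction m with
  | zero =>
    refine ⟨{0}, by simp, fun k hk => ?_⟩
    have h0 : ∑ j, |k j| = 0 :=
      le_antisymm (by simpa using hk) (Finset.sum_nonneg fun _ _ => abs_nonneg _)
    rw [Finset.sum_eq_zero_iff_of_nonneg fun _ _ => abs_nonneg _] at h0
    rw [Finset.mem_singleton]
    funext j
    simpa using h0 j (Finset.mem_univ j)
  | succ m ih =>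
    obtain ⟨S, hS, hmem⟩ := ih
    set D : Finset (Fin n → ℤ) :=
      insert 0 (Finset.univ.image (fun j => (Pi.single j 1 : Fin n → ℤ)) ∪
        Finset.univ.image (fun j => (Pi.single j (-1) : Fin n → ℤ))) with hD
    have hDcard : D.card ≤ 2 * n + 1 := by
      refine (Finset.card_insert_le _ _).trans ?_
      have h1 := Finset.card_union_le
        (Finset.univ.image (fun j => (Pi.single j 1 : Fin n → ℤ)))
        (Finset.univ.image (fun j => (Pi.single j (-1) : Fin n → ℤ)))
      have h2 := Finset.card_image_le (s := Finset.univ)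
        (f := fun j => (Pi.single j 1 : Fin n → ℤ))
      have h3 := Finset.card_image_le (s := Finset.univ)
        (f := fun j => (Pi.single j (-1) : Fin n → ℤ))
      simp only [Finset.card_univ, Fintype.card_fin] at h2 h3
      omega
    refine ⟨Finset.image₂ (· + ·) S D, ?_, fun k hk => ?_⟩
    · calc _ ≤ S.card * D.card := Finset.card_image₂_le _ _ _
        _ ≤ (2 * n + 1) ^ m * (2 * n + 1) := Nat.mul_le_mul hS hDcard
        _ = _ := (pow_succ _ _).symm
    · by_cases hk0 : k = 0
      · exact Finset.mem_image₂.2 ⟨0, hmem 0 (by simp), 0, by simp [hD], by simp [hk0]⟩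
      · obtain ⟨j, hj⟩ := Function.ne_iff.1 hk0
        have key : ∀ e : ℤ, |k j - e| = |k j| - 1 →
            ∑ i, |(k - Pi.single j e : Fin n → ℤ) i| ≤ (m : ℤ) := by
          intro e he
          rw [← Finset.add_sum_erase _ _ (Finset.mem_univ j)] at hk ⊢
          have : ∑ i ∈ Finset.univ.erase j, |(k - Pi.single j e : Fin n → ℤ) i|
              = ∑ i ∈ Finset.univ.erase j, |k i| := by
            refine Finset.sum_congr rfl fun i hi => ?_
            simp [Pi.single_eq_of_ne (Finset.ne_of_mem_erase hi)]
          rw [this, Pi.sub_apply, Pi.single_eq_same, he]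
          push_cast at hk
          linarith
        simp only [Pi.zero_apply] at hj
        rcases lt_or_gt_of_ne hj with h | h
        · refine Finset.mem_image₂.2 ⟨k - Pi.single j (-1), hmem _ (key _ ?_),
            Pi.single j (-1), by simp [hD], by simp⟩
          rw [abs_of_neg h, abs_of_nonpos (by omega)]
          ring
        · refine Finset.mem_image₂.2 ⟨k - Pi.single j 1, hmem _ (key _ ?_),
            Pi.single j 1, by simp [hD], by simp⟩
          rw [abs_of_pos h, abs_of_nonneg (by omega)]

/-- Rounding towards zero. -/
lemma exists_int_abs_le_abs_sub_le_one (x : ℝ) : ∃ k : ℤ, |(k : ℝ)| ≤ |x| ∧ |x - k| ≤ 1 := by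
  rcases le_total 0 x with h | h
  · have hk : (0 : ℝ) ≤ ⌊x⌋ := by exact_mod_cast Int.floor_nonneg.2 h
    refine ⟨⌊x⌋, ?_, ?_⟩
    · rw [abs_of_nonneg hk, abs_of_nonneg h]
      exact Int.floor_le x
    · rw [abs_le]
      constructor <;> linarith [Int.floor_le x, Int.lt_floor_add_one x]
  · have hk : (⌈x⌉ : ℝ) ≤ 0 := by exact_mod_cast Int.ceil_le.2 (by simpa using h)
    refine ⟨⌈x⌉, ?_, ?_⟩
    · rw [abs_of_nonpos hk, abs_of_nonpos h]
      linarith [Int.le_ceil x]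
    · rw [abs_le]
      constructor <;> linarith [Int.le_ceil x, Int.ceil_lt_add_one x]

lemma measurableSet_cube (d : ℕ) : MeasurableSet (cube d) :=
  MeasurableSet.univ_pi fun _ => measurableSet_Icc

lemma volume_cube (d : ℕ) : volume (cube d) = 1 := by
  rw [cube, volume_pi_pi]
  simp

lemma measurableSet_fragment {d : ℕ} {f : (Fin d → ℝ) → ℝ} (hf : Measurable f) :
    MeasurableSet (fragment f) :=
  (measurable_fst (measurableSet_cube d)).inter
    ((measurable_snd measurableSet_Icc).inter
      (measurableSet_le measurable_snd (hf.comp measurable_fst)))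

lemma measurable_fExp {d L n : ℕ} (I : Fin L → Finset (Fin n)) {ψ : Fin n → (Fin d → ℝ) → ℝ}
    (hψ : ∀ k, Measurable (ψ k)) (α : Fin n → ℝ) : Measurable (fExp I ψ α) :=
  Finset.measurable_fun_sum _ fun _ _ =>
    Finset.measurable_fun_sum _ fun j _ => (hψ j).const_mul (α j)

/-- The part of `[0,1]^{d+1}` within vertical distance `u` of the graph of `g`. -/
def graphStrip {d : ℕ} (g : (Fin d → ℝ) → ℝ) (u : ℝ) : Set ((Fin d → ℝ) × ℝ) :=
  {p | p ∈ cubeP d ∧ g p.1 - u ≤ p.2 ∧ p.2 ≤ g p.1 + u}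

lemma measurableSet_graphStrip {d : ℕ} {g : (Fin d → ℝ) → ℝ} (hg : Measurable g) (u : ℝ) :
    MeasurableSet (graphStrip g u) :=
  ((measurableSet_cube d).prod measurableSet_Icc).inter
    ((measurableSet_le ((hg.comp measurable_fst).sub_const u) measurable_snd).inter
      (measurableSet_le measurable_snd ((hg.comp measurable_fst).add_const u)))

lemma volume_graphStrip_le {d : ℕ} {g : (Fin d → ℝ) → ℝ} (hg : Measurable g) (u : ℝ) :
    volume (graphStrip g u) ≤ ENNReal.ofReal (2 * u) := by
  rw [Measure.volume_eq_prod, Measure.prod_apply (measurableSet_graphStrip hg u)]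
  calc ∫⁻ s, volume (Prod.mk s ⁻¹' graphStrip g u)
      ≤ ∫⁻ s, (cube d).indicator (fun _ => ENNReal.ofReal (2 * u)) s := by
        refine lintegral_mono fun s => ?_
        by_cases hs : s ∈ cube d
        · rw [Set.indicator_of_mem hs]
          refine (measure_mono (t := Set.Icc (g s - u) (g s + u)) fun t ht => ht.2).trans ?_
          rw [Real.volume_Icc]
          exact ENNReal.ofReal_le_ofReal (by linarith)
        · have : Prod.mk s ⁻¹' graphStrip g u = ∅ :=
            Set.eq_empty_of_forall_notMem fun t ht => hs ht.1.1
          simp [this]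
    _ = ENNReal.ofReal (2 * u) := by
        rw [lintegral_indicator_const (measurableSet_cube d), volume_cube, mul_one]

/-- A measure on the cube with density at most `q0` gives the strip mass at most `2 * q0 * u`. -/
lemma withDensity_graphStrip_le {d : ℕ} {q : ((Fin d → ℝ) × ℝ) → ℝ} {q0 : ℝ} (hq0 : 0 ≤ q0)
    (hq : ∀ x ∈ cubeP d, q x ≤ q0) {g : (Fin d → ℝ) → ℝ} (hg : Measurable g) (u : ℝ) :
    (volume.restrict (cubeP d)).withDensity (fun x => ENNReal.ofReal (q x)) (graphStrip g u)
      ≤ ENNReal.ofReal (q0 * (2 * u)) := by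
  have hS := measurableSet_graphStrip hg u
  have hsub : graphStrip g u ⊆ cubeP d := fun p hp => hp.1
  rw [withDensity_apply _ hS, Measure.restrict_restrict hS, Set.inter_eq_self_of_subset_left hsub]
  calc ∫⁻ x in graphStrip g u, ENNReal.ofReal (q x)
      ≤ ∫⁻ _ in graphStrip g u, ENNReal.ofReal q0 :=
        setLIntegral_mono' hS fun x hx => ENNReal.ofReal_le_ofReal (hq x (hsub hx))
    _ = ENNReal.ofReal q0 * volume (graphStrip g u) := setLIntegral_const _ _
    _ ≤ ENNReal.ofReal q0 * ENNReal.ofReal (2 * u) := by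
        gcongr
        exact volume_graphStrip_le hg u
    _ = _ := (ENNReal.ofReal_mul hq0).symm

/-- Off the strip around `g`, a fragment of a function uniformly within `u` of `g` agrees with
the fragment of `g`. -/
lemma mem_fragment_iff_of_notMem_graphStrip {d : ℕ} {f g : (Fin d → ℝ) → ℝ} {u : ℝ}
    (hfg : ∀ s ∈ cube d, |f s - g s| ≤ u) {x : (Fin d → ℝ) × ℝ} (hx : x ∉ graphStrip g u) :
    x ∈ fragment f ↔ x ∈ fragment g := by
  refine and_congr_right fun hs => and_congr_right fun ht => ?_
  have h := abs_le.1 (hfg _ hs)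
  have hu : 0 ≤ u := (abs_nonneg _).trans (hfg _ hs)
  by_cases h1 : g x.1 - u ≤ x.2
  · have h2 : ¬ x.2 ≤ g x.1 + u := fun h2 => hx ⟨⟨hs, ht⟩, h1, h2⟩
    constructor <;> intro <;> linarith
  · constructor <;> intro <;> linarith

/-- The weighted `ℓ¹`-norm is dominated by the nonsparsity measure. -/
lemma sum_mul_sum_abs_le_NS {d L n : ℕ} (I : Fin L → Finset (Fin n)) (θ : Fin n → ℝ) :
    ∑ l : Fin L, (2:ℝ) ^ (((d * (l.1 + 1) : ℕ) : ℝ) / 2) * ∑ j ∈ I l, |θ j| ≤ NS d I θ := by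
  have h : ∀ l : Fin L, (2:ℝ) ^ (((d * (l.1 + 1) : ℕ) : ℝ) / 2) * ∑ j ∈ I l, |θ j|
      = ((2:ℝ) ^ (((d * (l.1 + 1) : ℕ) : ℝ) / 4) * Real.sqrt (∑ j ∈ I l, |θ j|)) ^ 2 := by
    intro l
    rw [mul_pow, Real.sq_sqrt (Finset.sum_nonneg fun _ _ => abs_nonneg _), ← Real.rpow_natCast,
      ← Real.rpow_mul (by norm_num)]
    congr 2
    push_cast
    ring
  simp_rw [h]
  exact Finset.sum_sq_le_sq_sum_of_nonneg fun _ _ => by positivity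

/-- The indices of an `AssumpB` system are partitioned by level. -/
lemma AssumpB.biUnion_eq_univ {d L n : ℕ} {I : Fin L → Finset (Fin n)}
    {ψ : Fin n → (Fin d → ℝ) → ℝ} {cψ : ℝ} (hB : AssumpB d L n I ψ cψ) :
    Finset.univ.biUnion I = Finset.univ := by
  rw [← Finset.card_eq_iff_eq_univ, Finset.card_biUnion fun l _ l' _ h => hB.disj l l' h, hB.total,
    Fintype.card_fin]

/-- Rounding the coefficients at level `l` to the grid of mesh `2^{-dl/2} e` moves the expansion
by at most `c_ψ L e` uniformly, and the rounded vector has small `ℓ¹`-norm in mesh units. -/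
lemma AssumpB.exists_int_approx {d L n : ℕ} {I : Fin L → Finset (Fin n)}
    {ψ : Fin n → (Fin d → ℝ) → ℝ} {cψ : ℝ} (hB : AssumpB d L n I ψ cψ) {e : ℝ} (he : 0 < e) :
    ∃ η : Fin n → ℝ, ∀ α β : Fin n → ℝ, ∃ k : Fin n → ℤ,
      (∑ j, |(k j : ℝ)|) ≤ NS d I (α - β) / e ∧
      ∀ s ∈ cube d,
        |fExp I ψ α s - fExp I ψ (fun j => β j + η j * k j) s| ≤ cψ * L * e := by
  have hcover : ∀ j, ∃ l, j ∈ I l := fun j => by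
    have := hB.biUnion_eq_univ ▸ Finset.mem_univ j
    simpa using this
  choose lev hlev using hcover
  have hlev_eq : ∀ l, ∀ j ∈ I l, lev j = l := fun l j hj => by
    by_contra h
    exact Finset.disjoint_left.1 (hB.disj _ _ h) (hlev j) hj
  set w : Fin L → ℝ := fun l => (2:ℝ) ^ (((d * (l.1 + 1) : ℕ) : ℝ) / 2) with hw
  have hwpos : ∀ l, 0 < w l := fun l => Real.rpow_pos_of_pos (by norm_num) _
  refine ⟨fun j => e / w (lev j), fun α β => ?_⟩
  choose k hk1 hk2 using fun j =>
    exists_int_abs_le_abs_sub_le_one ((α - β) j / (e / w (lev j)))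
  have hη : ∀ j, 0 < e / w (lev j) := fun j => div_pos he (hwpos _)
  refine ⟨k, ?_, fun s hs => ?_⟩
  · rw [← hB.biUnion_eq_univ, Finset.sum_biUnion fun l _ l' _ h => hB.disj l l' h]
    refine le_trans ?_ (div_le_div_of_nonneg_right (sum_mul_sum_abs_le_NS I (α - β)) he.le)
    rw [Finset.sum_div]
    refine Finset.sum_le_sum fun l _ => ?_
    rw [Finset.mul_sum, Finset.sum_div]
    refine Finset.sum_le_sum fun j hj => (hk1 j).trans (le_of_eq ?_)
    rw [abs_div, abs_of_pos (hη j), hlev_eq l j hj, div_div_eq_mul_div, mul_comm]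
  · have hterm : ∀ j, |α j - (β j + e / w (lev j) * k j)| ≤ e / w (lev j) := fun j => by
      have h : α j - (β j + e / w (lev j) * k j)
          = e / w (lev j) * ((α - β) j / (e / w (lev j)) - k j) := by
        rw [mul_sub, mul_div_cancel₀ _ (hη j).ne', Pi.sub_apply]
        ring
      rw [h, abs_mul, abs_of_pos (hη j)]
      exact mul_le_of_le_one_right (hη j).le (hk2 j)
    have hlevel : ∀ l, |∑ j ∈ I l, (α j - (β j + e / w (lev j) * k j)) * ψ j s| ≤ cψ * e := by
      intro l
      calc |∑ j ∈ I l, (α j - (β j + e / w (lev j) * k j)) * ψ j s|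
          ≤ ∑ j ∈ I l, |(α j - (β j + e / w (lev j) * k j)) * ψ j s| :=
            Finset.abs_sum_le_sum_abs _ _
        _ ≤ ∑ j ∈ I l, e / w l * |ψ j s| := by
            refine Finset.sum_le_sum fun j hj => ?_
            rw [abs_mul]
            have := hterm j
            rw [hlev_eq l j hj] at this ⊢
            gcongr
        _ = e / w l * ∑ j ∈ I l, |ψ j s| := (Finset.mul_sum _ _ _).symm
        _ ≤ e / w l * (cψ * w l) :=
            mul_le_mul_of_nonneg_left (hB.sup_bound l s hs) (div_pos he (hwpos l)).le
        _ = cψ * e := by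
            have := (hwpos l).ne'
            field_simp
    have hsub : fExp I ψ α s - fExp I ψ (fun j => β j + e / w (lev j) * k j) s
        = ∑ l, ∑ j ∈ I l, (α j - (β j + e / w (lev j) * k j)) * ψ j s := by
      simp only [fExp, ← Finset.sum_sub_distrib, sub_mul]
    rw [hsub]
    calc _ ≤ ∑ l : Fin L, |∑ j ∈ I l, (α j - (β j + e / w (lev j) * k j)) * ψ j s| :=
          Finset.abs_sum_le_sum_abs _ _
      _ ≤ ∑ _l : Fin L, cψ * e := Finset.sum_le_sum fun l _ => hlevel l
      _ = cψ * L * e := by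
          simp
          ring

lemma log_two_mul_add_one_le {n d q0 c δ : ℝ} (hn : 2 ≤ n) (hd : 0 < d) (hq0 : 1 ≤ q0)
    (hc : 1 ≤ c) (hδ0 : 0 < δ) (hδ1 : δ ≤ 1) (hlev : 1 ≤ c * Real.log n / d) :
    Real.log (2 * n + 1) ≤ 4 * Real.log (8 * q0 * c ^ 2 * n / (δ * d)) := by
  have hlog : Real.log n ≤ 2 * Real.sqrt n := by
    have h1 := Real.log_sqrt (x := n) (by linarith)
    have h2 := Real.log_le_sub_one_of_pos (Real.sqrt_pos.2 (by linarith : 0 < n))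
    linarith
  have hsq : Real.sqrt n * Real.sqrt n = n := Real.mul_self_sqrt (by linarith)
  have hs0 : 0 < Real.sqrt n := Real.sqrt_pos.2 (by linarith)
  have hdle : d ≤ c * (2 * Real.sqrt n) := by
    rw [one_le_div hd] at hlev
    exact hlev.trans (by gcongr)
  have hmain : 4 * Real.sqrt n ≤ 8 * q0 * c ^ 2 * n / (δ * d) := by
    rw [le_div_iff₀ (by positivity)]
    calc 4 * Real.sqrt n * (δ * d) ≤ 4 * Real.sqrt n * (1 * (c * (2 * Real.sqrt n))) := by gcongr
      _ = 8 * 1 * (c * 1) * (Real.sqrt n * Real.sqrt n) := by ring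
      _ = 8 * 1 * (c * 1) * n := by rw [hsq]
      _ ≤ 8 * q0 * (c * c) * n := by gcongr
      _ = _ := by ring
  calc Real.log (2 * n + 1) ≤ Real.log ((4 * Real.sqrt n) ^ 4) := by
        refine Real.log_le_log (by linarith) ?_
        have : (4 * Real.sqrt n) ^ 4 = 256 * (n * n) := by
          calc (4 * Real.sqrt n) ^ 4
              = 256 * ((Real.sqrt n * Real.sqrt n) * (Real.sqrt n * Real.sqrt n)) := by ring
            _ = 256 * (n * n) := by rw [hsq]
        rw [this]
        nlinarith
    _ = 4 * Real.log (4 * Real.sqrt n) := by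
        rw [Real.log_pow]
        norm_num
    _ ≤ _ := by gcongr

/-- Lemma 3: under Assumptions B and C, the `δ`-entropy with bracketing (w.r.t. `Q`) of the
class `𝒢^M = {G_α ∆ G_{α*} : I(α − α*) ≤ M}` is at most
`(M/δ)(8 q₀ c_ψ² (log n)/d) log(8 q₀ c_ψ² n/(δ d))`. -/
theorem lemma3_bracketing_entropy {d L n : ℕ} (hd : 0 < d) (hL : 0 < L) (hn : 0 < n)
    (I : Fin L → Finset (Fin n)) (ψ : Fin n → (Fin d → ℝ) → ℝ) (cψ : ℝ)
    (hB : AssumpB d L n I ψ cψ)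
    (q0 : ℝ) (hq0 : 1 ≤ q0) (Q : Measure ((Fin d → ℝ) × ℝ))
    (q : ((Fin d → ℝ) × ℝ) → ℝ) (hqmeas : Measurable q)
    (hqbound : ∀ x ∈ cubeP d, 1 / q0 ≤ q x ∧ q x ≤ q0)
    (hQ : Q = (volume.restrict (cubeP d)).withDensity (fun x => ENNReal.ofReal (q x)))
    (αstar : Fin n → ℝ) (M δ : ℝ) (hM0 : 0 < M) (hMn : M ≤ n) (hδ0 : 0 < δ) (hδ1 : δ ≤ 1) :
    ∃ (N : ℕ) (zL zU : Fin N → ((Fin d → ℝ) × ℝ) → ℝ),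
      0 < N ∧
      Real.log N ≤ (M / δ) * (8 * q0 * cψ ^ 2 * Real.log n / d) *
        Real.log (8 * q0 * cψ ^ 2 * n / (δ * d)) ∧
      (∀ i, Measurable (zL i) ∧ Measurable (zU i)) ∧
      (∀ i x, zL i x ≤ zU i x) ∧
      (∀ i, (∫ x, (zU i x - zL i x) ∂Q) ≤ δ) ∧
      ∀ α : Fin n → ℝ, NS d I (α - αstar) ≤ M →
        ∃ i, ∀ x,
          zL i x ≤ Set.indicator (fragment (fExp I ψ α) ∆ fragment (fExp I ψ αstar))
              (fun _ => (1:ℝ)) x ∧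
          Set.indicator (fragment (fExp I ψ α) ∆ fragment (fExp I ψ αstar))
              (fun _ => (1:ℝ)) x ≤ zU i x := by
  classical
  have hc : 0 < cψ := zero_lt_one.trans_le hB.one_le
  have hq0' : 0 < q0 := zero_lt_one.trans_le hq0
  have hLr : (0:ℝ) < L := by exact_mod_cast hL
  have hdr : (0:ℝ) < d := by exact_mod_cast hd
  have hlev : 1 ≤ cψ * Real.log n / d :=
    le_trans (by exact_mod_cast hL) hB.levels
  have hn2 : (2:ℝ) ≤ n := by
    have : n ≠ 1 := by
      rintro rfl
      norm_num at hlev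
    exact_mod_cast (by omega : 2 ≤ n)
  set e : ℝ := δ / (2 * q0 * cψ * L) with he_def
  have he : 0 < e := by positivity
  have hu : q0 * (2 * (cψ * L * e)) = δ := by
    rw [he_def]
    field_simp
  obtain ⟨η, hη⟩ := hB.exists_int_approx he
  set m : ℕ := ⌊M / e⌋₊ with hm
  obtain ⟨S, hScard, hSmem⟩ := exists_finset_int_l1_ball n m
  set g : (Fin n → ℤ) → (Fin d → ℝ) → ℝ :=
    fun k => fExp I ψ (fun j => αstar j + η j * k j) with hg_def
  have hg : ∀ k, Measurable (g k) := fun k => measurable_fExp I hB.meas _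
  set T : (Fin n → ℤ) → Set ((Fin d → ℝ) × ℝ) := fun k => graphStrip (g k) (cψ * L * e) with hT_def
  have hT : ∀ k, MeasurableSet (T k) := fun k => measurableSet_graphStrip (hg k) _
  set A : (Fin n → ℤ) → Set ((Fin d → ℝ) × ℝ) :=
    fun k => fragment (g k) ∆ fragment (fExp I ψ αstar) with hA_def
  have hA : ∀ k, MeasurableSet (A k) := fun k =>
    (measurableSet_fragment (hg k)).symmDiff
      (measurableSet_fragment (measurable_fExp I hB.meas αstar))
  have h0S : (0 : Fin n → ℤ) ∈ S := hSmem 0 (by simp)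
  have hSpos : 0 < S.card := Finset.card_pos.2 ⟨0, h0S⟩
  refine ⟨S.card, fun i => (A (S.equivFin.symm i) \ T (S.equivFin.symm i)).indicator fun _ => 1,
    fun i => (A (S.equivFin.symm i) ∪ T (S.equivFin.symm i)).indicator fun _ => 1,
    hSpos, ?_, fun i => ?_, fun i x => ?_, fun i => ?_, fun α hα => ?_⟩
  · have hlog := log_two_mul_add_one_le hn2 hdr hq0 hB.one_le hδ0 hδ1 hlev
    have hlog0 : 0 ≤ Real.log (2 * n + 1) := Real.log_nonneg (by linarith)
    have hMe : M / e = M / δ * (2 * q0 * cψ * L) := by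
      rw [he_def]
      field_simp
    calc Real.log S.card ≤ Real.log ((2 * n + 1) ^ m) :=
          Real.log_le_log (by exact_mod_cast hSpos) (by exact_mod_cast hScard)
      _ = m * Real.log (2 * n + 1) := Real.log_pow _ _
      _ ≤ M / e * Real.log (2 * n + 1) := by
          gcongr
          exact Nat.floor_le (by positivity)
      _ ≤ M / δ * (2 * q0 * cψ * (cψ * Real.log n / d)) * Real.log (2 * n + 1) := by
          rw [hMe]
          have := hB.levels
          gcongr
      _ ≤ M / δ * (2 * q0 * cψ * (cψ * Real.log n / d)) *
            (4 * Real.log (8 * q0 * cψ ^ 2 * n / (δ * d))) := by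
          gcongr
      _ = _ := by ring
  · exact ⟨measurable_const.indicator ((hA _).diff (hT _)),
      measurable_const.indicator ((hA _).union (hT _))⟩
  · exact Set.indicator_le_indicator_of_subset
      (Set.sdiff_subset.trans Set.subset_union_left) (fun _ => zero_le_one) x
  · set k : Fin n → ℤ := (S.equivFin.symm i).1
    have hdiff : ∀ x, (A k ∪ T k).indicator (fun _ => (1:ℝ)) x -
        (A k \ T k).indicator (fun _ => (1:ℝ)) x = (T k).indicator (fun _ => (1:ℝ)) x := by
      intro x
      by_cases hxA : x ∈ A k <;> by_cases hxT : x ∈ T k <;> simp [Set.indicator, hxA, hxT]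
    change (∫ x, ((A k ∪ T k).indicator (fun _ => (1:ℝ)) x -
      (A k \ T k).indicator (fun _ => (1:ℝ)) x) ∂Q) ≤ δ
    simp_rw [hdiff]
    rw [integral_indicator_const _ (hT k), smul_eq_mul, mul_one, hQ]
    refine ENNReal.toReal_le_of_le_ofReal hδ0.le ?_
    rw [← hu]
    exact withDensity_graphStrip_le hq0'.le (fun x hx => (hqbound x hx).2) (hg k) _
  · obtain ⟨k, hk1, hk2⟩ := hη α αstar
    have hkS : k ∈ S := by
      refine hSmem k ?_
      have h1 : ((∑ j, (k j).natAbs : ℕ) : ℝ) ≤ M / e := by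
        push_cast [Nat.cast_natAbs]
        exact hk1.trans (by gcongr)
      have h2 : ∑ j, (k j).natAbs ≤ m := Nat.le_floor h1
      have h3 : ((∑ j, (k j).natAbs : ℕ) : ℤ) ≤ m := by exact_mod_cast h2
      simpa using h3
    refine ⟨S.equivFin ⟨k, hkS⟩, fun x => ?_⟩
    simp only [Equiv.symm_apply_apply]
    have hoff : x ∉ T k →
        (x ∈ fragment (fExp I ψ α) ∆ fragment (fExp I ψ αstar) ↔ x ∈ A k) := fun hx => by
      simp only [hA_def, Set.mem_symmDiff, mem_fragment_iff_of_notMem_graphStrip hk2 hx, hg_def]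
    by_cases hxT : x ∈ T k
    · rw [Set.indicator_of_notMem (fun h => h.2 hxT), Set.indicator_of_mem (show x ∈ A k ∪ T k from Or.inr hxT)]
      exact ⟨Set.indicator_nonneg (fun _ _ => zero_le_one) x,
        Set.indicator_le_self' (fun _ _ => zero_le_one) x⟩
    · by_cases hxA : x ∈ A k
      · simp [Set.indicator, hoff hxT, hxA, hxT]
      · simp [Set.indicator, hoff hxT, hxA, hxT]
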